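/- arXiv:1207.1824 — 10 statements merged into one kernel-verified Lean document; each statement's English description precedes it below -/
import Mathlib

section
/- For every integer n ≥ 1, there exists a non-trivial two-coloring C of the d-dimensional lattice ℤ^d with d = 2n² − n and axis-sensitivity r(C) = n. In particular, there exists a non-trivial coloring C with d = 2·r(C)² − r(C). -/
open Function

section Lattice

variable {ι : Type*} [Fintype ι] [DecidableEq ι]

/-- A two-coloring of the lattice `ℤ^ι`: `false` = red, `true` = blue. -/
def sensAt (C : (ι → ℤ) → Bool) (x : ι → ℤ) : ℕ :=
  (Finset.univ.filter fun p : ι × Bool =>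
    C (Function.update x p.1 (x p.1 + if p.2 then 1 else -1)) ≠ C x).card

/-- The axis-sensitivity of `C` at the point `x`: the number of coordinate
directions along which some neighbor of `x` has a different color. -/
def axisSensAt (C : (ι → ℤ) → Bool) (x : ι → ℤ) : ℕ :=
  (Finset.univ.filter fun i : ι =>
    C (Function.update x i (x i + 1)) ≠ C x ∨
      C (Function.update x i (x i - 1)) ≠ C x).card

/-- The sensitivity `s(C)` of a coloring: the maximum of `s(C,x)` over all `x`. -/
noncomputable def sensSup (C : (ι → ℤ) → Bool) : ℕ := sSup (Set.range (sensAt C))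

/-- The axis-sensitivity `r(C)` of a coloring: the maximum of `r(C,x)` over all `x`. -/
noncomputable def axisSensSup (C : (ι → ℤ) → Bool) : ℕ := sSup (Set.range (axisSensAt C))

/-- The red sensitivity `s^R(C)`: maximum axis-sensitivity over red points. -/
noncomputable def redSens (C : (ι → ℤ) → Bool) : ℕ := sSup (axisSensAt C '' {x | C x = false})

/-- The blue sensitivity `s^B(C)`: maximum axis-sensitivity over blue points. -/
noncomputable def blueSens (C : (ι → ℤ) → Bool) : ℕ := sSup (axisSensAt C '' {x | C x = true})

/-- A coloring is non-trivial if the origin is red and each axis carries a blue point. -/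
def NontrivialColoring (C : (ι → ℤ) → Bool) : Prop :=
  C (fun _ => 0) = false ∧
    ∀ i : ι, ∃ m : ℤ, C (Function.update (fun _ => 0) i m) = true

/-- `y` is a neighbor of `x`: they differ by `±1` in exactly one coordinate. -/
def IsNeighbor (x y : ι → ℤ) : Prop :=
  ∃ i : ι, y = Function.update x i (x i + 1) ∨ y = Function.update x i (x i - 1)

/-- `k` is the min-width of `C`: the least positive integer such that on every axis
there is a blue point within distance `k` of the origin. -/
def MinWidth (C : (ι → ℤ) → Bool) (k : ℕ) : Prop :=
  IsLeast {w : ℕ | 0 < w ∧ ∀ i : ι, ∃ m : ℤ, |m| ≤ (w : ℤ) ∧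
    C (Function.update (fun _ => 0) i m) = true} k

end Lattice

section Construction

variable {ι : Type*}

/-- The coloring whose blue points are those lying in some affine coordinate subspace
`{x | x i = 3 ∧ ∀ j ∈ S i, x j = 0}`. -/
noncomputable def subspaceColoring (S : ι → Finset ι) (x : ι → ℤ) : Bool :=
  open Classical in decide (∃ i, x i = 3 ∧ ∀ j ∈ S i, x j = 0)

theorem subspaceColoring_eq_true {S : ι → Finset ι} {x : ι → ℤ} :
    subspaceColoring S x = true ↔ ∃ i, x i = 3 ∧ ∀ j ∈ S i, x j = 0 := by
  simp [subspaceColoring]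

theorem subspaceColoring_eq_false {S : ι → Finset ι} {x : ι → ℤ} :
    subspaceColoring S x = false ↔ ¬ ∃ i, x i = 3 ∧ ∀ j ∈ S i, x j = 0 := by
  rw [← subspaceColoring_eq_true, Bool.not_eq_true]

variable [DecidableEq ι]

theorem nontrivialColoring_subspaceColoring {S : ι → Finset ι} (hS : ∀ i, i ∉ S i) :
    NontrivialColoring (subspaceColoring S) := by
  refine ⟨subspaceColoring_eq_false.2 (by simp), fun i => ⟨3, ?_⟩⟩
  refine subspaceColoring_eq_true.2 ⟨i, by simp, fun j hj => ?_⟩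
  rw [update_of_ne (ne_of_mem_of_not_mem hj (hS i))]

variable [Fintype ι]

theorem axisSensAt_subspaceColoring_le_of_blue {S : ι → Finset ι} {m : ℕ}
    (hcard : ∀ i, (S i).card ≤ m) {x : ι → ℤ} (hx : subspaceColoring S x = true) :
    axisSensAt (subspaceColoring S) x ≤ m + 1 := by
  obtain ⟨i, hi, hiS⟩ := subspaceColoring_eq_true.1 hx
  refine (Finset.card_le_card (t := insert i (S i)) fun k hk => ?_).trans
    ((Finset.card_insert_le _ _).trans (Nat.add_le_add_right (hcard i) 1))
  by_contra hk'
  rw [Finset.mem_insert, not_or] at hk'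
  have key (v : ℤ) : subspaceColoring S (update x k v) = true := by
    refine subspaceColoring_eq_true.2 ⟨i, by rwa [update_of_ne (Ne.symm hk'.1)], fun j hj => ?_⟩
    rw [update_of_ne (ne_of_mem_of_not_mem hj hk'.2)]
    exact hiS j hj
  simp [key, hx] at hk

/-- At a red point, distinct sensitive axes lead to subspaces of distinct classes of `γ`, since
two subspaces of the same class are at distance at least `3`. -/
theorem axisSensAt_subspaceColoring_le_of_red {α : Type*} [Fintype α] {S : ι → Finset ι}
    (γ : ι → α) (hγ : ∀ i j, γ i = γ j → i ≠ j → j ∈ S i ∨ i ∈ S j)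
    {x : ι → ℤ} (hx : subspaceColoring S x = false) :
    axisSensAt (subspaceColoring S) x ≤ Fintype.card α := by
  have hred := subspaceColoring_eq_false.1 hx
  have step : ∀ k, (subspaceColoring S (update x k (x k + 1)) ≠ subspaceColoring S x ∨
      subspaceColoring S (update x k (x k - 1)) ≠ subspaceColoring S x) →
      ∃ i v, |v - x k| ≤ 1 ∧ update x k v i = 3 ∧ ∀ j ∈ S i, update x k v j = 0 := by
    intro k hk
    rw [hx, Bool.ne_false_iff, Bool.ne_false_iff, subspaceColoring_eq_true,
      subspaceColoring_eq_true] at hk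
    rcases hk with ⟨i, hi⟩ | ⟨i, hi⟩
    · exact ⟨i, _, by simp, hi⟩
    · exact ⟨i, _, by simp, hi⟩
  have near {k : ι} {v : ℤ} (hv : |v - x k| ≤ 1) (j : ι) : |update x k v j - x j| ≤ 1 := by
    rcases eq_or_ne j k with rfl | hj
    · simpa using hv
    · simp [update_of_ne hj]
  choose! f v hv hf hfS using step
  rw [← Finset.card_univ]
  refine Finset.card_le_card_of_injOn (γ ∘ f) (by simp) fun k hk l hl hkl => ?_
  simp only [Finset.coe_filter, Finset.mem_univ, true_and, Set.mem_ofPred_eq] at hk hl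
  have far {k l : ι} (hk : |v k - x k| ≤ 1) (hl : |v l - x l| ≤ 1)
      (h0 : update x k (v k) (f l) = 0) (h3 : update x l (v l) (f l) = 3) : False := by
    have h₁ := near hk (f l)
    have h₂ := near hl (f l)
    rw [h0, abs_le] at h₁
    rw [h3, abs_le] at h₂
    omega
  have hfkl : f k = f l := by
    by_contra hne
    rcases hγ _ _ hkl hne with h | h
    · exact far (hv k hk) (hv l hl) (hfS k hk _ h) (hf l hl)
    · exact far (hv l hl) (hv k hk) (hfS l hl _ h) (hf k hk)
  by_contra hne
  have agree (j : ι) : update x k (v k) j = x j ∨ update x l (v l) j = x j := by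
    rcases eq_or_ne j k with rfl | hj
    · exact Or.inr (update_of_ne hne _ _)
    · exact Or.inl (update_of_ne hj _ _)
  refine hred ⟨f k, ?_, fun j hj => ?_⟩
  · rcases agree (f k) with h | h
    · rw [← h, hf k hk]
    · rw [← h, hfkl, hf l hl]
  · rcases agree j with h | h
    · rw [← h, hfS k hk j hj]
    · rw [← h, hfS l hl j (hfkl ▸ hj)]

theorem card_add_one_le_axisSensAt_subspaceColoring {S : ι → Finset ι} (hS : ∀ i, i ∉ S i)
    (i : ι) :
    (S i).card + 1 ≤ axisSensAt (subspaceColoring S) (update (fun _ => 0) i 3) := by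
  rw [← Finset.card_insert_of_notMem (hS i)]
  refine Finset.card_le_card fun k hk => ?_
  have hblue : subspaceColoring S (update (fun _ => 0) i 3) = true :=
    subspaceColoring_eq_true.2 ⟨i, by simp, fun j hj => by
      rw [update_of_ne (ne_of_mem_of_not_mem hj (hS i))]⟩
  rw [Finset.mem_filter]
  refine ⟨Finset.mem_univ _, Or.inl ?_⟩
  rw [hblue, Ne, subspaceColoring_eq_true]
  rintro ⟨j, hj, hjS⟩
  rcases eq_or_ne k i with rfl | hki
  · rcases eq_or_ne j k with rfl | hjk
    · simp at hj
    · simp [update_of_ne hjk] at hj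
  · have hji : j = i := by
      by_contra hji
      rcases eq_or_ne j k with rfl | hjk
      · simp [update_of_ne hji] at hj
      · simp [update_of_ne hji, update_of_ne hjk] at hj
    subst hji
    have := hjS k ((Finset.mem_insert.1 hk).resolve_left hki)
    simp [update_of_ne hki] at this

theorem axisSensSup_subspaceColoring {α : Type*} [Fintype α] [Nonempty ι] {S : ι → Finset ι}
    (γ : ι → α) (hγ : ∀ i j, γ i = γ j → i ≠ j → j ∈ S i ∨ i ∈ S j) (hS : ∀ i, i ∉ S i)
    (hcard : ∀ i, (S i).card + 1 = Fintype.card α) :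
    axisSensSup (subspaceColoring S) = Fintype.card α := by
  obtain ⟨i⟩ := ‹Nonempty ι›
  have upper (x : ι → ℤ) : axisSensAt (subspaceColoring S) x ≤ Fintype.card α := by
    cases hx : subspaceColoring S x with
    | false => exact axisSensAt_subspaceColoring_le_of_red γ hγ hx
    | true =>
      rw [← hcard i]
      refine axisSensAt_subspaceColoring_le_of_blue (fun j => ?_) hx
      have := hcard i
      have := hcard j
      omega
  have bound : Fintype.card α ∈ upperBounds (Set.range (axisSensAt (subspaceColoring S))) := by
    rintro _ ⟨x, rfl⟩
    exact upper x
  refine le_antisymm (csSup_le (Set.range_nonempty _) bound) ?_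
  rw [← hcard i]
  exact (card_add_one_le_axisSensAt_subspaceColoring hS i).trans
    (le_csSup ⟨_, bound⟩ ⟨_, rfl⟩)

end Construction

/-- The out-neighborhood of `u` in the rotational tournament on `ZMod (2 * m + 1)`. -/
def rotationalOut (m : ℕ) (u : ZMod (2 * m + 1)) : Finset (ZMod (2 * m + 1)) :=
  (Finset.Icc 1 m).image fun t : ℕ => u + t

theorem card_rotationalOut (m : ℕ) (u : ZMod (2 * m + 1)) : (rotationalOut m u).card = m := by
  rw [rotationalOut, Finset.card_image_of_injOn, Nat.card_Icc, Nat.add_sub_cancel]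
  intro s hs t ht h
  simp only [Finset.coe_Icc, Set.mem_Icc] at hs ht
  have h' := (ZMod.natCast_eq_natCast_iff' s t (2 * m + 1)).1 (add_left_cancel h)
  rwa [Nat.mod_eq_of_lt (by omega), Nat.mod_eq_of_lt (by omega)] at h'

theorem notMem_rotationalOut (m : ℕ) (u : ZMod (2 * m + 1)) : u ∉ rotationalOut m u := by
  simp only [rotationalOut, Finset.mem_image, Finset.mem_Icc, add_eq_left, not_exists, not_and]
  intro t ht h
  have := Nat.le_of_dvd (by omega) ((ZMod.natCast_eq_zero_iff _ _).1 h)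
  omega

theorem mem_rotationalOut_or_mem {m : ℕ} {u v : ZMod (2 * m + 1)} (h : u ≠ v) :
    v ∈ rotationalOut m u ∨ u ∈ rotationalOut m v := by
  have hlt := ZMod.val_lt (v - u)
  have hcast := ZMod.natCast_zmod_val (v - u)
  have hpos : (v - u).val ≠ 0 := by
    rw [Ne, ZMod.val_eq_zero, sub_eq_zero]
    exact h.symm
  simp only [rotationalOut, Finset.mem_image, Finset.mem_Icc]
  rcases le_or_gt (v - u).val m with hle | hgt
  · exact Or.inl ⟨(v - u).val, ⟨by omega, hle⟩, by rw [hcast]; ring⟩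
  · refine Or.inr ⟨2 * m + 1 - (v - u).val, ⟨by omega, by omega⟩, ?_⟩
    rw [Nat.cast_sub hlt.le, hcast, ZMod.natCast_self]
    ring

theorem exists_nontrivialColoring_axisSensSup_eq (m : ℕ) {ι : Type*} [Fintype ι] [DecidableEq ι]
    (e : ι ≃ Fin (m + 1) × ZMod (2 * m + 1)) :
    ∃ C : (ι → ℤ) → Bool, NontrivialColoring C ∧ axisSensSup C = m + 1 := by
  have : Nonempty ι := ⟨e.symm (0, 0)⟩
  let S (i : ι) : Finset ι :=
    ({(e i).1} ×ˢ rotationalOut m (e i).2).map e.symm.toEmbedding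
  have mem_S (i j : ι) : j ∈ S i ↔ (e j).1 = (e i).1 ∧ (e j).2 ∈ rotationalOut m (e i).2 := by
    simp only [S, Finset.mem_map_equiv, Equiv.symm_symm, Finset.mem_product,
      Finset.mem_singleton]
  have hS (i : ι) : i ∉ S i := by simp [mem_S, notMem_rotationalOut]
  refine ⟨subspaceColoring S, nontrivialColoring_subspaceColoring hS, ?_⟩
  rw [axisSensSup_subspaceColoring (fun i => (e i).1) (fun i j h hne => ?_) hS (fun i => ?_),
    Fintype.card_fin]
  · have hne' : (e i).2 ≠ (e j).2 := fun h' => hne (e.injective (Prod.ext h h'))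
    simpa [mem_S, h] using mem_rotationalOut_or_mem hne'
  · simp [S, card_rotationalOut]

/-- For every `n ≥ 1` there exists a non-trivial coloring `C` of
`ℤ^(2n²-n)` with axis-sensitivity `r(C) = n`; in particular there is a non-trivial
coloring with `d = 2·r(C)² - r(C)`. -/
theorem exists_nontrivial_coloring_quadratic_separation (n : ℕ) (hn : 1 ≤ n) :
    (∃ C : (Fin (2 * n ^ 2 - n) → ℤ) → Bool,
      NontrivialColoring C ∧ axisSensSup C = n) ∧
    ∃ (d : ℕ) (C : (Fin d → ℤ) → Bool),
      NontrivialColoring C ∧ d = 2 * (axisSensSup C) ^ 2 - axisSensSup C := by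
  have key : ∃ C : (Fin (2 * n ^ 2 - n) → ℤ) → Bool,
      NontrivialColoring C ∧ axisSensSup C = n := by
    obtain ⟨m, rfl⟩ := Nat.exists_eq_add_of_le' hn
    refine exists_nontrivialColoring_axisSensSup_eq m (Fintype.equivOfCardEq ?_)
    rw [Fintype.card_fin, Fintype.card_prod, Fintype.card_fin, ZMod.card]
    refine Nat.sub_eq_of_eq_add ?_
    ring
  obtain ⟨C, hC, hr⟩ := key
  exact ⟨⟨C, hC, hr⟩, _, C, hC, by rw [hr]⟩
end

section
/- In the slice coloring C of ℤ^{n(2n−1)}, every blue point x has axis-sensitivity r(C,x) ≤ n: if x lies in the slice S_{(a,b)}, then only changes to one of the n coordinates (a,b), (a,b+1), …, (a,b+n−1) can yield an adjacent red point. -/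
open Function

section Slice

/-- Membership in the slice `S_{(a,b)}` of `ℤ^(n(2n-1))`: the `(a,b)` coordinate
equals `3` and the coordinates `(a, b+1), …, (a, b+n-1)` (second index mod `2n-1`)
equal `0`; the remaining coordinates are free. -/
def inSlice (n : ℕ) (x : Fin n × Fin (2 * n - 1) → ℤ) (a : Fin n) (b : Fin (2 * n - 1)) :
    Prop :=
  x (a, b) = 3 ∧
    ∀ t : ℕ, 1 ≤ t → t ≤ n - 1 →
      x (a, ⟨(b.val + t) % (2 * n - 1), Nat.mod_lt _ ((Nat.zero_le b.val).trans_lt b.isLt)⟩) = 0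

open Classical in
/-- The slice coloring of `ℤ^(n(2n-1))`: a point is blue iff it lies in some slice. -/
noncomputable def sliceColoring (n : ℕ) (x : Fin n × Fin (2 * n - 1) → ℤ) : Bool :=
  decide (∃ (a : Fin n) (b : Fin (2 * n - 1)), inSlice n x a b)

end Slice

/-- Changing a coordinate outside those constrained by `S_{(a,b)}` preserves membership. -/
theorem inSlice_update {n : ℕ} (hn : 1 ≤ n) {x : Fin n × Fin (2 * n - 1) → ℤ} {a : Fin n}
    {b : Fin (2 * n - 1)} (h : inSlice n x a b) {i : Fin n × Fin (2 * n - 1)}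
    (hi : ∀ t < n,
      i ≠ (a, ⟨(b.val + t) % (2 * n - 1), Nat.mod_lt _ ((Nat.zero_le b.val).trans_lt b.isLt)⟩))
    (v : ℤ) : inSlice n (Function.update x i v) a b := by
  refine ⟨?_, fun t ht htn => ?_⟩
  · have hb : i ≠ (a, b) := by simpa [Nat.mod_eq_of_lt b.isLt] using hi 0 hn
    rw [Function.update_of_ne hb.symm]
    exact h.1
  · rw [Function.update_of_ne (hi t (by omega)).symm]
    exact h.2 t ht htn

theorem sliceColoring_eq_true_iff {n : ℕ} {x : Fin n × Fin (2 * n - 1) → ℤ} :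
    sliceColoring n x = true ↔ ∃ a b, inSlice n x a b := by
  simp [sliceColoring]

/-- In the slice coloring of `ℤ^(n(2n-1))`, every blue point has
axis-sensitivity at most `n`. -/
theorem sliceColoring_blue_axisSens_le (n : ℕ) (hn : 1 ≤ n)
    (x : Fin n × Fin (2 * n - 1) → ℤ) (hx : sliceColoring n x = true) :
    axisSensAt (sliceColoring n) x ≤ n := by
  obtain ⟨a, b, h⟩ := sliceColoring_eq_true_iff.1 hx
  let f : ℕ → Fin n × Fin (2 * n - 1) := fun t =>
    (a, ⟨(b.val + t) % (2 * n - 1), Nat.mod_lt _ ((Nat.zero_le b.val).trans_lt b.isLt)⟩)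
  calc axisSensAt (sliceColoring n) x ≤ ((Finset.range n).image f).card := by
        refine Finset.card_le_card fun i hi => ?_
        by_contra hf
        have key (v : ℤ) : sliceColoring n (Function.update x i v) = true :=
          sliceColoring_eq_true_iff.2 ⟨a, b, inSlice_update hn h
            (fun t ht e => hf (Finset.mem_image.2 ⟨t, Finset.mem_range.2 ht, e.symm⟩)) v⟩
        simp [key, hx] at hi
    _ ≤ n := Finset.card_image_le.trans (Finset.card_range n).le
end

section
/- In the slice coloring C of ℤ^{n(2n−1)}, for each red point x and each fixed a ∈ {1,…,n}, x has a neighbor lying in at most one slice of the form S_{(a,j)}; consequently every red point has axis-sensitivity r(C,x) ≤ n. -/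
open Function

theorem IsNeighbor.abs_sub_le {ι : Type*} [DecidableEq ι] {x y : ι → ℤ} (h : IsNeighbor x y)
    (i : ι) : |y i - x i| ≤ 1 := by
  obtain ⟨j, rfl | rfl⟩ := h <;> by_cases hij : i = j
  · subst hij; simp
  · simp [hij]
  · subst hij; simp
  · simp [hij]

/-- Of two distinct residues modulo `2n-1`, one lies among the `n-1` cyclic successors
of the other. -/
theorem exists_cyclic_offset {n : ℕ} {b c : Fin (2 * n - 1)} (h : b ≠ c) :
    ∃ t : ℕ, 1 ≤ t ∧ t ≤ n - 1 ∧
      ((b.val + t) % (2 * n - 1) = c.val ∨ (c.val + t) % (2 * n - 1) = b.val) := by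
  wlog hlt : b.val < c.val generalizing b c
  · obtain ⟨t, h₁, h₂, h₃⟩ := this h.symm (by have := Fin.val_ne_of_ne h; omega)
    exact ⟨t, h₁, h₂, h₃.symm⟩
  have hc := c.isLt
  by_cases hd : c.val - b.val ≤ n - 1
  · refine ⟨c.val - b.val, by omega, hd, Or.inl ?_⟩
    rw [Nat.add_sub_cancel' hlt.le, Nat.mod_eq_of_lt hc]
  · refine ⟨2 * n - 1 - (c.val - b.val), by omega, by omega, Or.inr ?_⟩
    have : c.val + (2 * n - 1 - (c.val - b.val)) = b.val + (2 * n - 1) := by omega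
    rw [this, Nat.add_mod_right, Nat.mod_eq_of_lt b.isLt]

theorem subsingleton_slices_of_neighbors (n : ℕ) (x : Fin n × Fin (2 * n - 1) → ℤ) (a : Fin n) :
    {b : Fin (2 * n - 1) | ∃ y, IsNeighbor x y ∧ inSlice n y a b}.Subsingleton := by
  rintro b ⟨y, hy, hyb⟩ c ⟨z, hz, hzc⟩
  by_contra hbc
  obtain ⟨t, ht₁, ht₂, ht | ht⟩ := exists_cyclic_offset hbc
  · have h₀ := hyb.2 t ht₁ ht₂
    have h₃ := hzc.1
    simp only [ht, Fin.eta] at h₀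
    have hy' := abs_le.1 (hy.abs_sub_le (a, c))
    have hz' := abs_le.1 (hz.abs_sub_le (a, c))
    omega
  · have h₀ := hzc.2 t ht₁ ht₂
    have h₃ := hyb.1
    simp only [ht, Fin.eta] at h₀
    have hy' := abs_le.1 (hy.abs_sub_le (a, b))
    have hz' := abs_le.1 (hz.abs_sub_le (a, b))
    omega

/-- If every coordinate `(a, j)` of `x` agrees with one of two points of a slice,
then `x` lies in the slice. -/
theorem inSlice_of_forall_eq_or_eq {n : ℕ} {x y z : Fin n × Fin (2 * n - 1) → ℤ} {a : Fin n}
    {b : Fin (2 * n - 1)} (hy : inSlice n y a b) (hz : inSlice n z a b)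
    (h : ∀ j, x (a, j) = y (a, j) ∨ x (a, j) = z (a, j)) : inSlice n x a b := by
  refine ⟨?_, fun t ht₁ ht₂ => ?_⟩
  · rcases h b with h | h
    · exact h.trans hy.1
    · exact h.trans hz.1
  · rcases h _ with h | h
    · exact h.trans (hy.2 t ht₁ ht₂)
    · exact h.trans (hz.2 t ht₁ ht₂)

/-- In the slice coloring of `ℤ^(n(2n-1))`, for each red point `x` and
each fixed `a`, at most one slice of the form `S_{(a,j)}` contains a neighbor of `x`;
consequently every red point has axis-sensitivity at most `n`. -/
theorem sliceColoring_red_axisSens_le (n : ℕ) (hn : 1 ≤ n)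
    (x : Fin n × Fin (2 * n - 1) → ℤ) (hx : sliceColoring n x = false) :
    (∀ a : Fin n,
      {b : Fin (2 * n - 1) | ∃ y, IsNeighbor x y ∧ inSlice n y a b}.Subsingleton) ∧
    axisSensAt (sliceColoring n) x ≤ n := by
  refine ⟨subsingleton_slices_of_neighbors n x, ?_⟩
  have hred : ∀ a b, ¬ inSlice n x a b := by simpa [sliceColoring] using hx
  have key : ∀ i : Fin n × Fin (2 * n - 1),
      (sliceColoring n (Function.update x i (x i + 1)) ≠ sliceColoring n x ∨
        sliceColoring n (Function.update x i (x i - 1)) ≠ sliceColoring n x) →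
      ∃ y b, IsNeighbor x y ∧ (∀ j, j ≠ i → x j = y j) ∧ inSlice n y i.1 b := by
    intro i hi
    obtain ⟨y, hy, hyi, a, b, hab⟩ : ∃ y, IsNeighbor x y ∧ (∀ j, j ≠ i → x j = y j) ∧
        ∃ a b, inSlice n y a b := by
      rcases hi with hi | hi
      · exact ⟨_, ⟨i, Or.inl rfl⟩, fun j hj => by simp [hj],
          by rw [hx] at hi; simpa [sliceColoring] using hi⟩
      · exact ⟨_, ⟨i, Or.inr rfl⟩, fun j hj => by simp [hj],
          by rw [hx] at hi; simpa [sliceColoring] using hi⟩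
    have hai : a = i.1 := by
      by_contra hne
      exact hred a b (inSlice_of_forall_eq_or_eq hab hab fun j =>
        Or.inl (hyi _ fun h => hne (congrArg Prod.fst h)))
    exact ⟨y, b, hy, hyi, hai ▸ hab⟩
  calc axisSensAt (sliceColoring n) x ≤ (Finset.univ : Finset (Fin n)).card := by
        refine Finset.card_le_card_of_injOn Prod.fst (fun _ _ => Finset.mem_univ _) ?_
        intro i hi j hj hij
        obtain ⟨y, b, hy, hyi, hyb⟩ := key i (Finset.mem_filter.1 hi).2
        obtain ⟨z, c, hz, hzj, hzc⟩ := key j (Finset.mem_filter.1 hj).2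
        rw [← hij] at hzc
        obtain rfl := subsingleton_slices_of_neighbors n x i.1 ⟨y, hy, hyb⟩ ⟨z, hz, hzc⟩
        by_contra hne
        refine hred _ _ (inSlice_of_forall_eq_or_eq hyb hzc fun k => ?_)
        by_cases hk : (i.1, k) = i
        · exact Or.inr (hzj _ fun h => hne (hk.symm.trans h))
        · exact Or.inl (hyi _ hk)
    _ = n := by simp
end

section
/- For every Boolean function f : {0,1}^n → {0,1} with block sensitivity bs(f) = d ≥ 1, there exists a non-trivial two-coloring C of ℤ^d with s(C) ≤ s(f). -/
open Function

section BooleanFunctions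

/-- The sensitivity `s(f,x)` of a Boolean function at input `x`. -/
def bfSensAt {m : ℕ} (f : (Fin m → Bool) → Bool) (x : Fin m → Bool) : ℕ :=
  (Finset.univ.filter fun i : Fin m => f (Function.update x i (!x i)) ≠ f x).card

/-- The sensitivity `s(f)` of a Boolean function. -/
noncomputable def bfSens {m : ℕ} (f : (Fin m → Bool) → Bool) : ℕ := sSup (Set.range (bfSensAt f))

/-- `x^B`: the input `x` with all bits in the block `B` flipped. -/
def flipBlock {m : ℕ} (x : Fin m → Bool) (B : Finset (Fin m)) : Fin m → Bool :=
  fun i => if i ∈ B then !x i else x i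

/-- The block sensitivity `bs(f,x)`: the maximum number of pairwise disjoint
sensitive blocks for `x`. -/
noncomputable def bfBlockSensAt {m : ℕ} (f : (Fin m → Bool) → Bool) (x : Fin m → Bool) : ℕ :=
  sSup {t : ℕ | ∃ B : Fin t → Finset (Fin m),
    (∀ i j, i ≠ j → Disjoint (B i) (B j)) ∧ ∀ i, f (flipBlock x (B i)) ≠ f x}

/-- The block sensitivity `bs(f)` of a Boolean function. -/
noncomputable def bfBlockSens {m : ℕ} (f : (Fin m → Bool) → Bool) : ℕ := sSup (Set.range (bfBlockSensAt f))

end BooleanFunctions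

theorem Nat.sSup_mem_of_pos {s : Set ℕ} (h : 0 < sSup s) : sSup s ∈ s := by
  refine Nat.sSup_mem ?_ ?_
  · rw [Set.nonempty_iff_ne_empty]
    rintro rfl
    simp at h
  · by_contra hb
    rw [Nat.sSup_of_not_bddAbove hb] at h
    exact h.false

theorem bfSensAt_le_bfSens {m : ℕ} (f : (Fin m → Bool) → Bool) (x : Fin m → Bool) :
    bfSensAt f x ≤ bfSens f :=
  le_csSup (Set.finite_range _).bddAbove ⟨x, rfl⟩

/-- Positive block sensitivity is attained by pairwise disjoint sensitive blocks. -/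
theorem exists_disjoint_sensitive_blocks {m : ℕ} (f : (Fin m → Bool) → Bool)
    (h : 0 < bfBlockSens f) :
    ∃ (x : Fin m → Bool) (B : Fin (bfBlockSens f) → Finset (Fin m)),
      (∀ i j, i ≠ j → Disjoint (B i) (B j)) ∧ ∀ i, f (flipBlock x (B i)) ≠ f x := by
  obtain ⟨x, hx⟩ := Nat.sSup_mem_of_pos h
  change bfBlockSensAt f x = bfBlockSens f at hx
  rw [← hx] at h ⊢
  exact ⟨x, Nat.sSup_mem_of_pos h⟩

open Classical in
/-- The cube point obtained from `x` by flipping, in each block `B i`, the bits `j < z i`. -/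
noncomputable def latticeToCube {ι : Type*} {m : ℕ} (x : Fin m → Bool) (B : ι → Finset (Fin m))
    (z : ι → ℤ) : Fin m → Bool :=
  fun j => if ∃ i, j ∈ B i ∧ (j : ℤ) < z i then !x j else x j

section LatticeToCube

variable {ι : Type*} {m : ℕ} (x : Fin m → Bool) {B : ι → Finset (Fin m)}

theorem latticeToCube_apply_of_mem (hB : Pairwise fun i j => Disjoint (B i) (B j))
    (z : ι → ℤ) {i : ι} {j : Fin m} (hj : j ∈ B i) :
    latticeToCube x B z j = if (j : ℤ) < z i then !x j else x j := by
  have hiff : (∃ k, j ∈ B k ∧ (j : ℤ) < z k) ↔ (j : ℤ) < z i := by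
    refine ⟨?_, fun h => ⟨i, hj, h⟩⟩
    rintro ⟨k, hk, hlt⟩
    by_cases hki : k = i
    · rwa [← hki]
    · exact absurd hj (Finset.disjoint_left.mp (hB hki) hk)
  simp only [latticeToCube, hiff]

theorem latticeToCube_zero : latticeToCube x B (fun _ => 0) = x := by
  funext j
  simp [latticeToCube]

theorem latticeToCube_apply_congr {w z : ι → ℤ} {j : Fin m} (h : ∀ k, j ∈ B k → w k = z k) :
    latticeToCube x B w j = latticeToCube x B z j := by
  classical
  have hiff : (∃ k, j ∈ B k ∧ (j : ℤ) < w k) ↔ ∃ k, j ∈ B k ∧ (j : ℤ) < z k :=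
    exists_congr fun k => and_congr_right fun hk => by rw [h k hk]
  simp only [latticeToCube, hiff]

variable [DecidableEq ι]

theorem latticeToCube_update_apply_of_notMem (z : ι → ℤ) {i : ι} {j : Fin m} (hj : j ∉ B i)
    (a : ℤ) : latticeToCube x B (update z i a) j = latticeToCube x B z j :=
  latticeToCube_apply_congr x fun _ hk => update_of_ne (ne_of_apply_ne B (ne_of_mem_of_not_mem' hk hj)) _ _

theorem latticeToCube_axis (hB : Pairwise fun i j => Disjoint (B i) (B j)) (i : ι) :
    latticeToCube x B (update (fun _ => 0) i (m : ℤ)) = flipBlock x (B i) := by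
  funext j
  by_cases hj : j ∈ B i
  · simp [latticeToCube_apply_of_mem x hB _ hj, flipBlock, hj]
  · rw [latticeToCube_update_apply_of_notMem x _ hj, latticeToCube_zero]
    simp [flipBlock, hj]

/-- A unit step in direction `i` that moves the cube point flips one bit of `B i`, and that bit
is determined by the step. -/
theorem latticeToCube_step (hB : Pairwise fun i j => Disjoint (B i) (B j)) (z : ι → ℤ) (i : ι)
    (b : Bool) (hne : latticeToCube x B (update z i (z i + if b then 1 else -1)) ≠
      latticeToCube x B z) :
    ∃ j ∈ B i, (j : ℤ) = (if b then z i else z i - 1) ∧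
      latticeToCube x B (update z i (z i + if b then 1 else -1)) =
        update (latticeToCube x B z) j (!latticeToCube x B z j) := by
  obtain ⟨j, hj⟩ := Function.ne_iff.mp hne
  have hjB : j ∈ B i := by
    by_contra h
    exact hj (latticeToCube_update_apply_of_notMem x z h _)
  have hval : (j : ℤ) = if b then z i else z i - 1 := by
    rw [latticeToCube_apply_of_mem x hB _ hjB, latticeToCube_apply_of_mem x hB _ hjB,
      update_self] at hj
    cases b <;> simp at hj ⊢ <;> split_ifs at hj <;> first | omega | simp at hj
  refine ⟨j, hjB, hval, ?_⟩
  funext k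
  by_cases hkj : k = j
  · subst hkj
    rw [update_self]
    exact Bool.eq_not_of_ne hj
  rw [update_of_ne hkj]
  by_cases hk : k ∈ B i
  · have hkj' : (k : ℤ) ≠ j := fun h => hkj (Fin.ext (by exact_mod_cast h))
    have hiff : (k : ℤ) < z i + (if b then 1 else -1) ↔ (k : ℤ) < z i := by
      cases b <;> simp at hval ⊢ <;> omega
    simp only [latticeToCube_apply_of_mem x hB _ hk, update_self, hiff]
  · exact latticeToCube_update_apply_of_notMem x z hk _

theorem sensAt_comp_latticeToCube_le [Fintype ι]
    (hB : Pairwise fun i j => Disjoint (B i) (B j)) (f : (Fin m → Bool) → Bool) (z : ι → ℤ) :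
    sensAt (f ∘ latticeToCube x B) z ≤ bfSensAt f (latticeToCube x B z) := by
  refine Finset.card_le_card_of_forall_subsingleton
    (fun (p : ι × Bool) (j : Fin m) => j ∈ B p.1 ∧ (j : ℤ) = if p.2 then z p.1 else z p.1 - 1)
    ?_ ?_
  · rintro ⟨i, b⟩ hp
    have hne := (Finset.mem_filter.mp hp).2
    obtain ⟨j, hjB, hval, hstep⟩ := latticeToCube_step x hB z i b
      fun h => hne (congrArg f h)
    refine ⟨j, Finset.mem_filter.mpr ⟨Finset.mem_univ _, ?_⟩, hjB, hval⟩
    rw [← hstep]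
    exact hne
  · rintro j - ⟨i, b⟩ ⟨-, hi, hb⟩ ⟨k, c⟩ ⟨-, hk, hc⟩
    have hik : i = k := by
      by_contra h
      exact Finset.disjoint_left.mp (hB h) hi hk
    subst hik
    cases b <;> cases c <;> simp at hb hc ⊢ <;> omega

end LatticeToCube

theorem bfSensAt_bne {m : ℕ} (f : (Fin m → Bool) → Bool) (c : Bool) :
    bfSensAt (fun y => f y != c) = bfSensAt f := by
  funext y
  simp [bfSensAt]

/-- For every Boolean function `f` with block sensitivity `bs(f) = d ≥ 1`
there exists a non-trivial coloring `C` of `ℤ^d` with `s(C) ≤ s(f)`. -/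
theorem coloring_of_boolean_function (m d : ℕ) (f : (Fin m → Bool) → Bool)
    (hbs : bfBlockSens f = d) (hd : 1 ≤ d) :
    ∃ C : (Fin d → ℤ) → Bool, NontrivialColoring C ∧ sensSup C ≤ bfSens f := by
  subst hbs
  obtain ⟨x, B, hdisj, hsens⟩ := exists_disjoint_sensitive_blocks f hd
  have hB : Pairwise fun i j => Disjoint (B i) (B j) := fun i j h => hdisj i j h
  refine ⟨(fun y => f y != f x) ∘ latticeToCube x B, ⟨?_, fun i => ⟨m, ?_⟩⟩, ?_⟩
  · simp [latticeToCube_zero]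
  · simpa [latticeToCube_axis x hB] using hsens i
  · refine csSup_le' ?_
    rintro _ ⟨z, rfl⟩
    refine (sensAt_comp_latticeToCube_le x hB _ z).trans ?_
    rw [bfSensAt_bne]
    exact bfSensAt_le_bfSens f _
end

section
/- For every non-trivial two-coloring C of ℤ^d with min-width k, there exists a Boolean function f (on finitely many input bits) such that bs(f) ≥ d and s(f) ≤ k · s(C). -/
open Function

/-- The lattice point encoded by `d` groups of `k` bits: the `i`-th coordinate has as absolute
value the Hamming weight of the `i`-th group, and its sign is `+` exactly when `σ i = true`. -/
def weightPoint {d k : ℕ} (σ : Fin d → Bool) (x : Fin (d * k) → Bool) : Fin d → ℤ :=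
  fun i => (if σ i then 1 else -1) * ∑ j : Fin k, if x (finProdFinEquiv (i, j)) then 1 else 0

lemma weightPoint_update_not {d k : ℕ} (σ : Fin d → Bool) (x : Fin (d * k) → Bool)
    (i : Fin d) (j : Fin k) :
    weightPoint σ (update x (finProdFinEquiv (i, j)) (!x (finProdFinEquiv (i, j)))) =
      update (weightPoint σ x) i (weightPoint σ x i +
        if (σ i != x (finProdFinEquiv (i, j))) then 1 else -1) := by
  funext i'
  by_cases h : i' = i
  · subst h
    rw [update_self]
    simp only [weightPoint]
    rw [← Finset.add_sum_erase _ _ (Finset.mem_univ j),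
      ← Finset.add_sum_erase (a := j) (f := fun j => if x (finProdFinEquiv (i', j)) then (1 : ℤ)
        else 0) _ (Finset.mem_univ j)]
    have hrest : ∀ l ∈ Finset.univ.erase j,
        (if update x (finProdFinEquiv (i', j)) (!x (finProdFinEquiv (i', j)))
          (finProdFinEquiv (i', l)) then (1 : ℤ) else 0) =
        if x (finProdFinEquiv (i', l)) then 1 else 0 := by
      intro l hl
      have hne : finProdFinEquiv (i', l) ≠ finProdFinEquiv (i', j) := by
        simpa using Finset.ne_of_mem_erase hl
      rw [update_of_ne hne]
    rw [Finset.sum_congr rfl hrest, update_self]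
    cases σ i' <;> cases x (finProdFinEquiv (i', j)) <;> grind
  · rw [update_of_ne h]
    have hne : ∀ l, finProdFinEquiv (i', l) ≠ finProdFinEquiv (i, j) := fun l => by
      simp [h]
    simp only [weightPoint, update_of_ne (hne _)]

lemma sensAt_le_sensSup {ι : Type*} [Fintype ι] [DecidableEq ι] (C : (ι → ℤ) → Bool)
    (x : ι → ℤ) : sensAt C x ≤ sensSup C := by
  refine le_csSup ⟨Fintype.card (ι × Bool), ?_⟩ ⟨x, rfl⟩
  rintro _ ⟨y, rfl⟩
  exact Finset.card_le_univ _

lemma bfSensAt_comp_weightPoint_le {d k : ℕ} (C : (Fin d → ℤ) → Bool) (σ : Fin d → Bool)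
    (x : Fin (d * k) → Bool) :
    bfSensAt (fun y => C (weightPoint σ y)) x ≤ k * sensAt C (weightPoint σ x) := by
  refine Finset.card_le_mul_card_image_of_maps_to
    (f := fun p : Fin (d * k) => ((finProdFinEquiv.symm p).1,
      (σ (finProdFinEquiv.symm p).1 != x p))) ?_ k ?_
  · intro p hp
    obtain ⟨⟨i, j⟩, rfl⟩ := finProdFinEquiv.surjective p
    simpa [weightPoint_update_not] using hp
  · rintro ⟨i, b⟩ -
    calc _ ≤ (Finset.univ.image fun j : Fin k => finProdFinEquiv (i, j)).card := by
          refine Finset.card_le_card fun p hp => ?_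
          obtain ⟨⟨i', j⟩, rfl⟩ := finProdFinEquiv.surjective p
          have h := (Finset.mem_filter.mp hp).2
          simp only [Equiv.symm_apply_apply, Prod.mk.injEq] at h
          exact Finset.mem_image.mpr ⟨j, Finset.mem_univ _, by rw [h.1]⟩
      _ ≤ k := Finset.card_image_le.trans (by simp)

lemma card_le_of_sensitive_blocks {m t : ℕ} {f : (Fin m → Bool) → Bool} {x : Fin m → Bool}
    {B : Fin t → Finset (Fin m)} (hdisj : ∀ i j, i ≠ j → Disjoint (B i) (B j))
    (hsens : ∀ i, f (flipBlock x (B i)) ≠ f x) : t ≤ m := by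
  have hne : ∀ i, (B i).Nonempty := fun i => by
    rw [Finset.nonempty_iff_ne_empty]
    intro h
    exact hsens i (congrArg f (funext fun l => by simp [flipBlock, h]))
  choose g hg using hne
  have hinj : Injective g := fun i j hij => by
    by_contra h
    exact Finset.disjoint_left.mp (hdisj i j h) (hg i) (hij ▸ hg j)
  simpa using Fintype.card_le_of_injective g hinj

lemma le_bfBlockSens {m t : ℕ} {f : (Fin m → Bool) → Bool} {x : Fin m → Bool}
    {B : Fin t → Finset (Fin m)} (hdisj : ∀ i j, i ≠ j → Disjoint (B i) (B j))
    (hsens : ∀ i, f (flipBlock x (B i)) ≠ f x) : t ≤ bfBlockSens f :=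
  calc t ≤ bfBlockSensAt f x :=
        le_csSup ⟨m, fun _ ⟨_, h, h'⟩ => card_le_of_sensitive_blocks h h'⟩ ⟨B, hdisj, hsens⟩
    _ ≤ bfBlockSens f := le_csSup (Set.finite_range _).bddAbove ⟨x, rfl⟩

/-- The block of the first `n` bits in the `i`-th group of `k` bits. -/
def initialBlock {d : ℕ} (k : ℕ) (i : Fin d) (n : ℕ) : Finset (Fin (d * k)) :=
  Finset.univ.filter fun p =>
    (finProdFinEquiv.symm p).1 = i ∧ ((finProdFinEquiv.symm p).2 : ℕ) < n

lemma mem_initialBlock {d k n : ℕ} {i i' : Fin d} {j : Fin k} :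
    finProdFinEquiv (i', j) ∈ initialBlock k i n ↔ i' = i ∧ (j : ℕ) < n := by
  rw [initialBlock, Finset.mem_filter, Equiv.symm_apply_apply]
  simp

lemma weightPoint_flipBlock_initialBlock {d k n : ℕ} (σ : Fin d → Bool) (i : Fin d)
    (hn : n ≤ k) :
    weightPoint σ (flipBlock (fun _ => false) (initialBlock k i n)) =
      update (fun _ => 0) i ((if σ i then 1 else -1) * (n : ℤ)) := by
  funext i'
  by_cases h : i' = i
  · subst h
    have hcard : (Finset.univ.filter fun j : Fin k => (j : ℕ) < n).card = n := by
      rw [Fin.card_filter_val_lt]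
      exact min_eq_right hn
    simp [weightPoint, flipBlock, mem_initialBlock, Finset.sum_boole, hcard]
  · simp [weightPoint, flipBlock, mem_initialBlock, h]

/-- For every non-trivial coloring `C` of `ℤ^d` with min-width `k` there
is a Boolean function `f` (on finitely many bits) with `bs(f) ≥ d` and `s(f) ≤ k·s(C)`. -/
theorem boolean_function_of_coloring (d k : ℕ) (C : (Fin d → ℤ) → Bool)
    (hC : NontrivialColoring C) (hk : MinWidth C k) :
    ∃ (m : ℕ) (f : (Fin m → Bool) → Bool),
      d ≤ bfBlockSens f ∧ bfSens f ≤ k * sensSup C := by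
  choose w hw hblue using hk.1.2
  let σ : Fin d → Bool := fun i => decide (0 ≤ w i)
  refine ⟨d * k, fun x => C (weightPoint σ x), ?_, ?_⟩
  · refine le_bfBlockSens (x := fun _ => false)
      (B := fun i => initialBlock k i (w i).natAbs) ?_ ?_
    · intro i j hij
      refine Finset.disjoint_left.mpr fun p hp hq => hij ?_
      exact (Finset.mem_filter.mp hp).2.1.symm.trans (Finset.mem_filter.mp hq).2.1
    · intro i
      have hred : weightPoint σ (fun _ : Fin (d * k) => false) = fun _ => 0 := by
        funext i
        simp [weightPoint]
      have hsign : (if σ i then 1 else -1) * ((w i).natAbs : ℤ) = w i := by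
        by_cases h : 0 ≤ w i
        · simp [σ, h]
        · simp [σ, h, abs_of_neg (not_le.mp h)]
      have hle : (w i).natAbs ≤ k := by
        have := hw i
        rw [Int.abs_eq_natAbs] at this
        exact_mod_cast this
      simp only [weightPoint_flipBlock_initialBlock σ i hle, hsign, hred, hblue, hC.1]
      simp
  · refine csSup_le (Set.range_nonempty _) ?_
    rintro _ ⟨x, rfl⟩
    exact (bfSensAt_comp_weightPoint_le C σ x).trans
      (Nat.mul_le_mul_left k (sensAt_le_sensSup C _))
end

section
/- For every repeated coloring C in nk dimensions (built from a non-trivial coloring C' of ℤ^k with s^R(C') = 1), the red sensitivity of C satisfies s^R(C) = n. -/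
open Function

section Repeated

/-- `C` is a repeated coloring in `nk` dimensions built from `C'`: `C'` is a
non-trivial coloring of `ℤ^k` with red sensitivity `1`, and a point `x` is blue
in `C` iff some block `x_i` of `x` is blue in `C'`. -/
def IsRepeatedColoring (n k : ℕ) (C : (Fin n × Fin k → ℤ) → Bool)
    (C' : (Fin k → ℤ) → Bool) : Prop :=
  NontrivialColoring C' ∧ redSens C' = 1 ∧
    ∀ x : Fin n × Fin k → ℤ, C x = true ↔ ∃ i : Fin n, C' (fun j => x (i, j)) = true

end Repeated

section AxisSensitivity

variable {ι : Type*} [Fintype ι] [DecidableEq ι]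

theorem bddAbove_axisSensAt_image (C : (ι → ℤ) → Bool) (s : Set (ι → ℤ)) :
    BddAbove (axisSensAt C '' s) := by
  refine ⟨Fintype.card ι, ?_⟩
  rintro _ ⟨x, -, rfl⟩
  exact Finset.card_le_univ _

theorem axisSensAt_le_redSens {C : (ι → ℤ) → Bool} {x : ι → ℤ} (hx : C x = false) :
    axisSensAt C x ≤ redSens C :=
  le_csSup (bddAbove_axisSensAt_image C _) ⟨x, hx, rfl⟩

theorem exists_axisSensAt_eq_redSens {C : (ι → ℤ) → Bool} (hC : ∃ x, C x = false) :
    ∃ x, C x = false ∧ axisSensAt C x = redSens C := by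
  obtain ⟨x₀, hx₀⟩ := hC
  have hne : (axisSensAt C '' {x | C x = false}).Nonempty := ⟨_, x₀, hx₀, rfl⟩
  exact Nat.sSup_mem hne (bddAbove_axisSensAt_image C _)

end AxisSensitivity

section BlockwiseOr

variable {α β : Type*} {C : (α × β → ℤ) → Bool} {C' : (β → ℤ) → Bool}

theorem color_eq_false_iff_blocks
    (hC : ∀ x, C x = true ↔ ∃ i, C' (fun j => x (i, j)) = true) (x : α × β → ℤ) :
    C x = false ↔ ∀ i, C' (fun j => x (i, j)) = false := by
  simp only [← Bool.not_eq_true, hC, not_exists]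

variable [DecidableEq α] [DecidableEq β]

theorem color_update_eq_block
    (hC : ∀ x, C x = true ↔ ∃ i, C' (fun j => x (i, j)) = true)
    {x : α × β → ℤ} (hx : C x = false) (i : α) (j : β) (v : ℤ) :
    C (update x (i, j) v) = C' (update (fun j' => x (i, j')) j v) := by
  have hblocks := (color_eq_false_iff_blocks hC x).1 hx
  have hself : (fun j' => update x (i, j) v (i, j')) = update (fun j' => x (i, j')) j v := by
    funext j'
    simp [update_apply]
  rw [Bool.eq_iff_iff, hC]
  constructor
  · rintro ⟨i', hi'⟩
    by_cases h : i' = i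
    · subst h
      rwa [hself] at hi'
    · simp [h, hblocks i'] at hi'
  · intro h
    exact ⟨i, by rwa [hself]⟩

variable [Fintype α] [Fintype β]

/-- At a red point of a blockwise disjunction, the axis-sensitivity is the sum of the
axis-sensitivities of the blocks. -/
theorem axisSensAt_eq_sum_blocks
    (hC : ∀ x, C x = true ↔ ∃ i, C' (fun j => x (i, j)) = true)
    {x : α × β → ℤ} (hx : C x = false) :
    axisSensAt C x = ∑ i, axisSensAt C' (fun j => x (i, j)) := by
  have hblocks := (color_eq_false_iff_blocks hC x).1 hx
  simp only [axisSensAt, Finset.card_filter, Fintype.sum_prod_type]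
  refine Finset.sum_congr rfl fun i _ => Finset.sum_congr rfl fun j _ => ?_
  simp only [color_update_eq_block hC hx, hx, hblocks i]

/-- The red sensitivity of a blockwise disjunction is the number of blocks times the red
sensitivity of a block. -/
theorem redSens_eq_card_mul
    (hC : ∀ x, C x = true ↔ ∃ i, C' (fun j => x (i, j)) = true)
    (hred : ∃ y, C' y = false) :
    redSens C = Fintype.card α * redSens C' := by
  obtain ⟨y, hy, hsens⟩ := exists_axisSensAt_eq_redSens hred
  have hxred : C (fun p => y p.2) = false := (color_eq_false_iff_blocks hC _).2 fun _ => hy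
  apply le_antisymm
  · obtain ⟨x, hx, hxsens⟩ := exists_axisSensAt_eq_redSens ⟨_, hxred⟩
    rw [← hxsens, axisSensAt_eq_sum_blocks hC hx]
    refine (Finset.sum_le_card_nsmul _ _ (redSens C') fun i _ =>
      axisSensAt_le_redSens ((color_eq_false_iff_blocks hC x).1 hx i)).trans_eq ?_
    simp
  · refine le_trans (le_of_eq ?_) (axisSensAt_le_redSens hxred)
    simp [axisSensAt_eq_sum_blocks hC hxred, hsens]

end BlockwiseOr

/-- Every repeated coloring `C` in `nk` dimensions has red sensitivity
`s^R(C) = n`. -/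
theorem repeated_redSens (n k : ℕ) (C : (Fin n × Fin k → ℤ) → Bool)
    (C' : (Fin k → ℤ) → Bool) (h : IsRepeatedColoring n k C C') :
    redSens C = n := by
  obtain ⟨⟨hred, -⟩, hsens, hC⟩ := h
  simp [redSens_eq_card_mul hC ⟨_, hred⟩, hsens]
end

section
/- For every repeated coloring C in nk dimensions (built from a non-trivial coloring C' of ℤ^k with s^R(C') = 1), the blue sensitivities coincide: s^B(C) = s^B(C'). -/
open Function

section RepeatedAux

variable {ι κ : Type*} [DecidableEq ι] [DecidableEq κ]

/-- Updating one coordinate of block `i` updates that block accordingly. -/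
theorem block_update_self (x : ι × κ → ℤ) (i : ι) (j : κ) (v : ℤ) :
    (fun l => update x (i, j) v (i, l)) = update (fun l => x (i, l)) j v := by
  funext l
  by_cases hl : l = j <;> simp [hl]

/-- Updating one coordinate of block `a` leaves the other blocks unchanged. -/
theorem block_update_of_ne (x : ι × κ → ℤ) {i a : ι} (hia : i ≠ a) (j : κ) (v : ℤ) :
    (fun l => update x (a, j) v (i, l)) = fun l => x (i, l) := by
  funext l
  simp [hia]

variable [Fintype ι]

theorem axisSensAt_le_card (C : (ι → ℤ) → Bool) (x : ι → ℤ) :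
    axisSensAt C x ≤ Fintype.card ι :=
  Finset.card_le_univ _

theorem axisSensAt_le_blueSens (C : (ι → ℤ) → Bool) {x : ι → ℤ} (hx : C x = true) :
    axisSensAt C x ≤ blueSens C := by
  refine le_csSup ⟨Fintype.card ι, ?_⟩ ⟨x, hx, rfl⟩
  rintro _ ⟨y, -, rfl⟩
  exact axisSensAt_le_card C y

theorem blueSens_le {C : (ι → ℤ) → Bool} {b : ℕ}
    (hb : ∀ x, C x = true → axisSensAt C x ≤ b) : blueSens C ≤ b := by
  refine csSup_le' ?_
  rintro _ ⟨x, hx, rfl⟩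
  exact hb x hx

variable [Fintype κ] {C : (ι × κ → ℤ) → Bool} {C' : (κ → ℤ) → Bool}

/-- At a point with a blue block, the sensitivity of a block-wise disjunction is at most
the sensitivity of that block. -/
theorem axisSensAt_le_axisSensAt_block
    (hC : ∀ x, C x = true ↔ ∃ i, C' (fun j => x (i, j)) = true)
    {x : ι × κ → ℤ} {i : ι} (hi : C' (fun j => x (i, j)) = true) :
    axisSensAt C x ≤ axisSensAt C' (fun j => x (i, j)) := by
  have hx : C x = true := (hC x).2 ⟨i, hi⟩
  have key : ∀ (a : ι) (j : κ) (v : ℤ), C (update x (a, j) v) ≠ true →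
      a = i ∧ C' (update (fun l => x (i, l)) j v) ≠ true := by
    intro a j v hv
    have hred := fun hb => hv ((hC _).2 ⟨i, hb⟩)
    by_cases ha : i = a
    · subst ha
      rw [block_update_self] at hred
      exact ⟨rfl, hred⟩
    · rw [block_update_of_ne x ha] at hred
      exact absurd hi hred
  refine (Finset.card_le_card ?_).trans (Finset.card_image_le (f := fun j => (i, j)))
  rintro ⟨a, j⟩ haj
  simp only [Finset.mem_filter, Finset.mem_univ, true_and, hx] at haj
  simp only [Finset.mem_image, Finset.mem_filter, Finset.mem_univ, true_and, hi]
  rcases haj with h | h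
  · obtain ⟨rfl, h'⟩ := key a j _ h
    exact ⟨j, Or.inl h', rfl⟩
  · obtain ⟨rfl, h'⟩ := key a j _ h
    exact ⟨j, Or.inr h', rfl⟩

/-- At a point with exactly one blue block, the sensitivity of a block-wise disjunction is
at least the sensitivity of that block. -/
theorem axisSensAt_block_le_axisSensAt
    (hC : ∀ x, C x = true ↔ ∃ i, C' (fun j => x (i, j)) = true)
    {x : ι × κ → ℤ} {i : ι} (hi : C' (fun j => x (i, j)) = true)
    (hne : ∀ a, a ≠ i → C' (fun j => x (a, j)) = false) :
    axisSensAt C' (fun j => x (i, j)) ≤ axisSensAt C x := by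
  have hx : C x = true := (hC x).2 ⟨i, hi⟩
  have key : ∀ (j : κ) (v : ℤ), C' (update (fun l => x (i, l)) j v) ≠ true →
      C (update x (i, j) v) ≠ true := by
    intro j v hv hb
    obtain ⟨a, ha⟩ := (hC _).1 hb
    by_cases hai : a = i
    · subst hai
      rw [block_update_self] at ha
      exact hv ha
    · rw [block_update_of_ne x hai, hne a hai] at ha
      exact Bool.false_ne_true ha
  refine Finset.card_le_card_of_injOn (fun j => (i, j)) ?_ fun a _ b _ h => congrArg Prod.snd h
  intro j hj
  simp only [Finset.coe_filter, Finset.mem_univ, true_and, Set.mem_ofPred_eq, hi] at hj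
  simp only [Finset.coe_filter, Finset.mem_univ, true_and, Set.mem_ofPred_eq, hx]
  exact hj.imp (key j _) (key j _)

end RepeatedAux

/-- For every repeated coloring `C` in `nk` dimensions built from `C'`,
the blue sensitivities coincide: `s^B(C) = s^B(C')`. -/
theorem repeated_blueSens (n k : ℕ) (hn : 1 ≤ n) (C : (Fin n × Fin k → ℤ) → Bool)
    (C' : (Fin k → ℤ) → Bool) (h : IsRepeatedColoring n k C C') :
    blueSens C = blueSens C' := by
  obtain ⟨⟨h0, -⟩, -, hC⟩ := h
  apply le_antisymm
  · refine blueSens_le fun x hx => ?_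
    obtain ⟨i, hi⟩ := (hC x).1 hx
    exact (axisSensAt_le_axisSensAt_block hC hi).trans (axisSensAt_le_blueSens C' hi)
  · refine blueSens_le fun y hy => ?_
    let i : Fin n := ⟨0, hn⟩
    let x : Fin n × Fin k → ℤ := fun p => if p.1 = i then y p.2 else 0
    have hxi : (fun j => x (i, j)) = y := by simp [x]
    have hne : ∀ a, a ≠ i → C' (fun j => x (a, j)) = false := fun a ha => by
      simpa [x, ha] using h0
    have hi : C' (fun j => x (i, j)) = true := hxi.symm ▸ hy
    calc axisSensAt C' y = axisSensAt C' (fun j => x (i, j)) := by rw [hxi]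
      _ ≤ axisSensAt C x := axisSensAt_block_le_axisSensAt hC hi hne
      _ ≤ blueSens C := axisSensAt_le_blueSens C ((hC x).2 ⟨i, hi⟩)
end

section
/- For every sliced coloring C of ℤ^d, d ≤ 2·r(C)² − r(C). -/
open Function

section Sliced

/-- The slice of `ℤ^d` with nonzero coordinate `y` fixed to the constant `c`
and the coordinates in `X` fixed to `0`. -/
def sliceSet (d : ℕ) (y : Fin d) (c : ℤ) (X : Set (Fin d)) : Set (Fin d → ℤ) :=
  {x | x y = c ∧ ∀ i ∈ X, x i = 0}

/-- `C` is a sliced coloring with nonzero constants `c i ≥ 3` and zero sets `X i`: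
it is non-trivial and its blue points are exactly the union of the `d` slices
`S_i = sliceSet d i (c i) (X i)`, where `S_i` has its nonzero coordinate in dimension `i`. -/
def IsSlicedColoring (d : ℕ) (C : (Fin d → ℤ) → Bool) (c : Fin d → ℤ)
    (X : Fin d → Set (Fin d)) : Prop :=
  NontrivialColoring C ∧ (∀ i, 3 ≤ c i) ∧ (∀ i, i ∉ X i) ∧
    ∀ x, C x = true ↔ ∃ i : Fin d, x ∈ sliceSet d i (c i) (X i)

end Sliced

lemma axisSensAt_le_axisSensSup {ι : Type*} [Fintype ι] [DecidableEq ι] (C : (ι → ℤ) → Bool)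
    (x : ι → ℤ) : axisSensAt C x ≤ axisSensSup C := by
  refine le_csSup ⟨Fintype.card ι, ?_⟩ ⟨x, rfl⟩
  rintro _ ⟨y, rfl⟩
  exact Finset.card_le_univ _

/-- In a finite digraph with out-degrees at most `k`, some vertex has in-degree at most `k`. -/
lemma exists_card_filter_mem_le {α : Type*} [DecidableEq α] (N : α → Finset α) (k : ℕ)
    (hN : ∀ v, (N v).card ≤ k) (S : Finset α) (hS : S.Nonempty) :
    ∃ v ∈ S, (S.filter fun u => v ∈ N u).card ≤ k := by
  refine Finset.exists_le_of_sum_le hS ?_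
  have key := Finset.sum_card_bipartiteAbove_eq_sum_card_bipartiteBelow
    (s := S) (t := S) (fun u v => v ∈ N u)
  simp only [Finset.bipartiteAbove, Finset.bipartiteBelow] at key
  rw [← key]
  refine Finset.sum_le_sum fun u _ => (Finset.card_le_card fun v hv => ?_).trans (hN u)
  exact (Finset.mem_filter.1 hv).2

/-- A finite digraph on `S` with out-degrees at most `k` has an independent set with at least
`|S| / (2k + 1)` vertices. -/
lemma exists_independent_card_le {α : Type*} [DecidableEq α] (N : α → Finset α) (k : ℕ)
    (hN : ∀ v, (N v).card ≤ k) (hirr : ∀ v, v ∉ N v) (S : Finset α) :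
    ∃ I ⊆ S, (∀ u ∈ I, ∀ v ∈ I, v ∉ N u) ∧ S.card ≤ (2 * k + 1) * I.card := by
  induction S using Finset.strongInduction with
  | H S ih =>
    rcases S.eq_empty_or_nonempty with rfl | hS
    · exact ⟨∅, by simp⟩
    obtain ⟨v, hvS, hv⟩ := exists_card_filter_mem_le N k hN S hS
    set R := insert v (N v ∪ S.filter fun u => v ∈ N u) with hR
    have hRcard : R.card ≤ 2 * k + 1 := by
      have h₁ := Finset.card_insert_le v (N v ∪ S.filter fun u => v ∈ N u)
      have h₂ := Finset.card_union_le (N v) (S.filter fun u => v ∈ N u)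
      have h₃ := hN v
      rw [← hR] at h₁
      omega
    have hss : S \ R ⊂ S :=
      Finset.ssubset_iff_subset_ne.2 ⟨Finset.sdiff_subset, fun h => by
        have := h ▸ hvS
        simp [hR] at this⟩
    obtain ⟨I, hIS, hI, hcard⟩ := ih _ hss
    have hout : ∀ u ∈ I, u ≠ v ∧ u ∉ N v ∧ v ∉ N u := fun u hu => by
      have := hIS hu
      simp only [hR, Finset.mem_sdiff, Finset.mem_insert, Finset.mem_union,
        Finset.mem_filter] at this
      tauto
    have hvI : v ∉ I := fun h => (hout v h).1 rfl
    refine ⟨insert v I, ?_, ?_, ?_⟩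
    · exact Finset.insert_subset hvS (hIS.trans Finset.sdiff_subset)
    · intro a ha b hb
      rw [Finset.mem_insert] at ha hb
      rcases ha with rfl | ha <;> rcases hb with rfl | hb
      · exact hirr _
      · exact (hout b hb).2.1
      · exact (hout a ha).2.2
      · exact hI a ha b hb
    · rw [Finset.card_insert_of_notMem hvI]
      have := Finset.card_le_card_sdiff_add_card (s := S) (t := R)
      linarith

namespace IsSlicedColoring

variable {d : ℕ} {C : (Fin d → ℤ) → Bool} {c : Fin d → ℤ} {X : Fin d → Set (Fin d)}

lemma eq_false_of_forall_ne (h : IsSlicedColoring d C c X) {x : Fin d → ℤ}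
    (hx : ∀ k, x k = c k → ∃ j ∈ X k, x j ≠ 0) : C x = false := by
  rw [← Bool.not_eq_true, h.2.2.2]
  rintro ⟨k, hk, hz⟩
  obtain ⟨j, hj, hne⟩ := hx k hk
  exact hne (hz j hj)

open Classical in
/-- A generic point of the slice `S_i` is sensitive in direction `i` and in every direction
of `X i`. -/
lemma card_zeroSet_lt (h : IsSlicedColoring d C c X) (i : Fin d) :
    (Finset.univ.filter (· ∈ X i)).card + 1 ≤ axisSensSup C := by
  set x : Fin d → ℤ := fun j => if j = i then c i else if j ∈ X i then 0 else 1 with hx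
  have hi : i ∉ X i := h.2.2.1 i
  have hxi : x i = c i := by simp [hx]
  have hX : ∀ j ∈ X i, x j = 0 := fun j hj => by
    have : j ≠ i := fun e => hi (e ▸ hj)
    simp [hx, this, hj]
  have hne : ∀ k, k ≠ i → x k = 0 ∨ x k = 1 := fun k hk => by
    by_cases hkX : k ∈ X i <;> simp [hx, hk, hkX]
  have hblue : C x = true := (h.2.2.2 x).2 ⟨i, hxi, hX⟩
  rw [← Finset.card_insert_of_notMem (a := i) (by simpa using hi)]
  refine (Finset.card_le_card fun j hj => ?_).trans (axisSensAt_le_axisSensSup C x)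
  refine Finset.mem_filter.2 ⟨Finset.mem_univ _, Or.inl ?_⟩
  rw [hblue, h.eq_false_of_forall_ne]
  · simp
  intro k hk
  have hc := h.2.1 k
  by_cases hki : k = i
  · subst hki
    by_cases hjk : j = k
    · subst hjk
      simp at hk
      omega
    · have hjX : j ∈ X k := by simpa [hjk] using hj
      exact ⟨j, hjX, by simp [hX j hjX]⟩
  · exfalso
    have := hne k hki
    by_cases hjk : k = j
    · subst hjk
      rw [Function.update_self] at hk
      omega
    · rw [Function.update_of_ne hjk] at hk
      omega

/-- If no two slices of `I` exclude each other, some red point is adjacent to all of them. -/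
lemma card_le_of_independent (h : IsSlicedColoring d C c X) (I : Finset (Fin d))
    (hI : ∀ i ∈ I, ∀ j ∈ I, j ∉ X i) : I.card ≤ axisSensSup C := by
  set x : Fin d → ℤ := fun j => if j ∈ I then c j - 1 else 0 with hx
  have hred : C x = false := h.eq_false_of_forall_ne fun k hk => by
    have hc := h.2.1 k
    simp only [hx] at hk
    split_ifs at hk <;> omega
  refine (Finset.card_le_card fun i hi => ?_).trans (axisSensAt_le_axisSensSup C x)
  refine Finset.mem_filter.2 ⟨Finset.mem_univ _, Or.inl ?_⟩
  rw [hred, (h.2.2.2 _).2 ⟨i, by simp [hx, hi], fun j hj => ?_⟩]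
  · simp
  · have hji : j ≠ i := fun e => h.2.2.1 i (e ▸ hj)
    have hjI : j ∉ I := fun hjI => hI i hi j hjI hj
    simp [hx, hji, hjI]

end IsSlicedColoring

/-- For every sliced coloring `C` of `ℤ^d`, `d ≤ 2·r(C)² - r(C)`. -/
theorem sliced_dimension_bound_axisSens (d : ℕ) (C : (Fin d → ℤ) → Bool)
    (c : Fin d → ℤ) (X : Fin d → Set (Fin d)) (h : IsSlicedColoring d C c X) :
    d ≤ 2 * (axisSensSup C) ^ 2 - axisSensSup C := by
  classical
  rcases Nat.eq_zero_or_pos d with rfl | hd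
  · exact Nat.zero_le _
  obtain ⟨k, hk⟩ : ∃ k, axisSensSup C = k + 1 :=
    Nat.exists_eq_succ_of_ne_zero (by have := h.card_zeroSet_lt ⟨0, hd⟩; omega)
  obtain ⟨I, -, hI, hcard⟩ := exists_independent_card_le
    (fun i => Finset.univ.filter (· ∈ X i)) k
    (fun i => by have := h.card_zeroSet_lt i; omega)
    (fun i => by simpa using h.2.2.1 i) Finset.univ
  have hIr := h.card_le_of_independent I fun i hi j hj => by simpa using hI i hi j hj
  rw [Finset.card_univ, Fintype.card_fin] at hcard
  rw [hk] at hIr ⊢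
  refine Nat.le_sub_of_add_le ?_
  nlinarith [Nat.mul_le_mul_left (2 * k + 1) hIr]
end

section
/- Let C be a non-trivial two-coloring of ℤ^d and define the doubled coloring C' of ℤ^d by C'(y) = C(x), where x_i = ⌈y_i/2⌉ for each i (so each point of C is replaced by a 2×2×…×2 block of points of the same color). Then C' is non-trivial and satisfies s(C',y) = r(C',y) for every point y, and s(C') = r(C') = r(C). In particular, every non-trivial coloring C with r(C) = n yields a non-trivial coloring C' in the same dimension d with s(C') = n. -/
open Function

/-- The doubled coloring: each point of `C` is replaced by a `2×⋯×2` block of points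
of the same color, via `C' y = C (⌈y/2⌉)` coordinatewise. -/
def doubledColoring (d : ℕ) (C : (Fin d → ℤ) → Bool) : (Fin d → ℤ) → Bool :=
  fun y => C fun i => ⌈(y i : ℚ) / 2⌉

theorem ceil_intCast_div_two (n : ℤ) : ⌈(n : ℚ) / 2⌉ = (n + 1) / 2 := by
  rw [Int.ceil_eq_iff]
  have h₁ : 2 * ((n + 1) / 2) < n + 2 := by omega
  have h₂ : n ≤ 2 * ((n + 1) / 2) := by omega
  have h₁' : 2 * (((n + 1) / 2 : ℤ) : ℚ) < n + 2 := by exact_mod_cast h₁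
  have h₂' : (n : ℚ) ≤ 2 * (((n + 1) / 2 : ℤ) : ℚ) := by exact_mod_cast h₂
  constructor <;> linarith

theorem doubledColoring_apply {d : ℕ} (C : (Fin d → ℤ) → Bool) (y : Fin d → ℤ) :
    doubledColoring d C y = C fun i => (y i + 1) / 2 := by
  simp only [doubledColoring, ceil_intCast_div_two]

theorem doubledColoring_update {d : ℕ} (C : (Fin d → ℤ) → Bool) (y : Fin d → ℤ) (i : Fin d)
    (m : ℤ) :
    doubledColoring d C (Function.update y i m) =
      C (Function.update (fun j => (y j + 1) / 2) i ((m + 1) / 2)) := by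
  rw [doubledColoring_apply]
  congr 1
  ext j
  by_cases h : j = i
  · subst h; simp
  · simp [h]

/-- A step that stays inside a block of the doubled coloring does not change the color. -/
theorem doubledColoring_update_of_eq {d : ℕ} (C : (Fin d → ℤ) → Bool) (y : Fin d → ℤ) (i : Fin d)
    (m : ℤ) (h : (m + 1) / 2 = (y i + 1) / 2) :
    doubledColoring d C (Function.update y i m) = doubledColoring d C y := by
  rw [doubledColoring_update, doubledColoring_apply, h, Function.update_eq_self]

theorem doubledColoring_succ_or_pred_eq {d : ℕ} (C : (Fin d → ℤ) → Bool) (y : Fin d → ℤ)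
    (i : Fin d) :
    doubledColoring d C (Function.update y i (y i + 1)) = doubledColoring d C y ∨
      doubledColoring d C (Function.update y i (y i - 1)) = doubledColoring d C y := by
  rcases Int.even_or_odd' (y i) with ⟨k, hk | hk⟩
  · exact Or.inr (doubledColoring_update_of_eq C y i _ (by omega))
  · exact Or.inl (doubledColoring_update_of_eq C y i _ (by omega))

theorem sensAt_doubledColoring {d : ℕ} (C : (Fin d → ℤ) → Bool) (y : Fin d → ℤ) :
    sensAt (doubledColoring d C) y = axisSensAt (doubledColoring d C) y := by
  unfold sensAt axisSensAt
  refine Finset.card_bij (fun p _ => p.1) ?_ ?_ ?_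
  · rintro ⟨i, b⟩ h
    cases b <;> simp_all [sub_eq_add_neg]
  · rintro ⟨i, b⟩ h ⟨j, c⟩ h' hij
    obtain rfl : i = j := hij
    have := doubledColoring_succ_or_pred_eq C y i
    cases b <;> cases c <;> simp_all [sub_eq_add_neg]
  · intro i h
    simp only [Finset.mem_filter, Finset.mem_univ, true_and] at h
    rcases h with h | h
    · exact ⟨(i, true), by simpa using h, rfl⟩
    · exact ⟨(i, false), by simpa [sub_eq_add_neg] using h, rfl⟩

theorem axisSensAt_doubledColoring_le {d : ℕ} (C : (Fin d → ℤ) → Bool) (y : Fin d → ℤ) :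
    axisSensAt (doubledColoring d C) y ≤ axisSensAt C fun i => (y i + 1) / 2 := by
  refine Finset.card_le_card fun i h => ?_
  simp only [Finset.mem_filter, Finset.mem_univ, true_and] at h ⊢
  rcases Int.even_or_odd' (y i) with ⟨k, hk | hk⟩
  · rw [doubledColoring_update_of_eq C y i (y i - 1) (by omega), doubledColoring_update,
      doubledColoring_apply, show (y i + 1 + 1) / 2 = (y i + 1) / 2 + 1 by omega] at h
    exact Or.inl (h.resolve_right (by simp))
  · rw [doubledColoring_update_of_eq C y i (y i + 1) (by omega), doubledColoring_update,
      doubledColoring_apply, show (y i - 1 + 1) / 2 = (y i + 1) / 2 - 1 by omega] at h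
    exact Or.inr (h.resolve_left (by simp))

/-- Every block has a corner that sees all the axis directions the original point is sensitive
in. -/
theorem exists_axisSensAt_le_doubledColoring {d : ℕ} (C : (Fin d → ℤ) → Bool) (x : Fin d → ℤ) :
    ∃ y, axisSensAt C x ≤ axisSensAt (doubledColoring d C) y := by
  set y : Fin d → ℤ := fun i =>
    if C (Function.update x i (x i + 1)) ≠ C x then 2 * x i else 2 * x i - 1 with hy
  have hyx : (fun i => (y i + 1) / 2) = x := by
    ext i
    simp only [hy]
    split_ifs <;> omega
  refine ⟨y, Finset.card_le_card fun i h => ?_⟩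
  simp only [Finset.mem_filter, Finset.mem_univ, true_and] at h ⊢
  rw [doubledColoring_update, doubledColoring_update, doubledColoring_apply, hyx]
  by_cases hi : C (Function.update x i (x i + 1)) ≠ C x
  · have hyi : y i = 2 * x i := if_pos hi
    left
    rwa [show (y i + 1 + 1) / 2 = x i + 1 by omega]
  · have hyi : y i = 2 * x i - 1 := if_neg hi
    right
    rw [show (y i - 1 + 1) / 2 = x i - 1 by omega]
    exact h.resolve_left hi

theorem bddAbove_range_axisSensAt {ι : Type*} [Fintype ι] [DecidableEq ι]
    (C : (ι → ℤ) → Bool) : BddAbove (Set.range (axisSensAt C)) :=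
  ⟨Fintype.card ι, by rintro _ ⟨x, rfl⟩; exact Finset.card_le_univ _⟩

theorem axisSensSup_doubledColoring {d : ℕ} (C : (Fin d → ℤ) → Bool) :
    axisSensSup (doubledColoring d C) = axisSensSup C := by
  apply le_antisymm
  · refine csSup_le (Set.range_nonempty _) ?_
    rintro _ ⟨y, rfl⟩
    exact (axisSensAt_doubledColoring_le C y).trans
      (le_csSup (bddAbove_range_axisSensAt C) (Set.mem_range_self _))
  · refine csSup_le (Set.range_nonempty _) ?_
    rintro _ ⟨x, rfl⟩
    obtain ⟨y, hxy⟩ := exists_axisSensAt_le_doubledColoring C x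
    exact hxy.trans (le_csSup (bddAbove_range_axisSensAt _) (Set.mem_range_self y))

theorem sensSup_doubledColoring {d : ℕ} (C : (Fin d → ℤ) → Bool) :
    sensSup (doubledColoring d C) = axisSensSup (doubledColoring d C) := by
  unfold sensSup axisSensSup
  rw [funext (sensAt_doubledColoring C)]

theorem NontrivialColoring.doubledColoring {d : ℕ} {C : (Fin d → ℤ) → Bool}
    (hC : NontrivialColoring C) : NontrivialColoring (doubledColoring d C) := by
  refine ⟨by simpa [doubledColoring_apply] using hC.1, fun i => ?_⟩
  obtain ⟨m, hm⟩ := hC.2 i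
  refine ⟨2 * m, ?_⟩
  rw [doubledColoring_update, show (2 * m + 1) / 2 = m by omega]
  simpa using hm

/-- The doubled coloring `C'` of a non-trivial coloring `C` is
non-trivial, satisfies `s(C',y) = r(C',y)` at every point, and
`s(C') = r(C') = r(C)`; in particular every non-trivial coloring with `r(C) = n`
yields a non-trivial coloring `C'` in the same dimension with `s(C') = n`. -/
theorem doubledColoring_spec (d : ℕ) (C : (Fin d → ℤ) → Bool)
    (hC : NontrivialColoring C) :
    NontrivialColoring (doubledColoring d C) ∧
    (∀ y : Fin d → ℤ,
      sensAt (doubledColoring d C) y = axisSensAt (doubledColoring d C) y) ∧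
    sensSup (doubledColoring d C) = axisSensSup (doubledColoring d C) ∧
    sensSup (doubledColoring d C) = axisSensSup C :=
  ⟨hC.doubledColoring, sensAt_doubledColoring C, sensSup_doubledColoring C,
    (sensSup_doubledColoring C).trans (axisSensSup_doubledColoring C)⟩
end

section
/- Let S_1,…,S_m be slices of ℤ^d, where S_t is determined by a nonzero coordinate y_t with constant c_t ≥ 3 and a zero set X_t ⊆ {1,…,d} (y_t ∉ X_t), and suppose the coordinates y_1,…,y_m are pairwise distinct. If the slices pairwise intersect (every two of them have a common point), then all m slices have a common point. -/
open Function

/-- Slices with pairwise distinct nonzero coordinates and constants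
`≥ 3` that pairwise intersect have a common point. -/
theorem slices_pairwise_intersect_common_point (d m : ℕ) (y : Fin m → Fin d)
    (c : Fin m → ℤ) (X : Fin m → Set (Fin d)) (hy : Function.Injective y)
    (hc : ∀ t, 3 ≤ c t) (hyX : ∀ t, y t ∉ X t)
    (hpair : ∀ s t : Fin m, ∃ p : Fin d → ℤ,
      p ∈ sliceSet d (y s) (c s) (X s) ∧ p ∈ sliceSet d (y t) (c t) (X t)) :
    ∃ p : Fin d → ℤ, ∀ t : Fin m, p ∈ sliceSet d (y t) (c t) (X t) := by
  refine ⟨Function.extend y c 0, fun t => ⟨hy.extend_apply c 0 t, fun i hi => ?_⟩⟩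
  by_cases h : ∃ s, y s = i
  · obtain ⟨s, rfl⟩ := h
    obtain ⟨p, hs, ht⟩ := hpair s t
    have hcs : c s = 0 := hs.1.symm.trans (ht.2 _ hi)
    have := hc s
    omega
  · exact Function.extend_apply' c (0 : Fin d → ℤ) i h
end
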